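/- Let A be a ring, u ∈ Mat_{I×J}(A), v ∈ Mat_{J×I}(A) with uvu = 0, vuv = 0, and uvzvu = 0 for a given z ∈ Mat_{I×J}(A). Then the double commutator ⟦⟦e₊(u), e₋(v)⟧, e₊(z)⟧ equals e₊(−(uvz + zvu)), i.e., e₊ of minus the Jordan triple product {u, v, z}. -/

import Mathlib

/-- If `uvu = 0` and `vuv = 0`, then `⟦e₊(u), e₋(v)⟧` is the block diagonal matrix with
blocks `1 - uv` and `1 + vu`. -/
theorem Matrix.fromBlocks_upper_lower_commutator {A : Type*} [Ring A] {I J : Type*}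
    [Fintype I] [Fintype J] [DecidableEq I] [DecidableEq J]
    (u : Matrix I J A) (v : Matrix J I A)
    (huvu : u * v * u = 0) (hvuv : v * u * v = 0) :
    Matrix.fromBlocks 1 u 0 1 * Matrix.fromBlocks 1 0 (-v) 1 *
        Matrix.fromBlocks 1 (-u) 0 1 * Matrix.fromBlocks 1 0 v 1 =
      Matrix.fromBlocks (1 - u * v) 0 0 (1 + v * u) := by
  simp [Matrix.fromBlocks_multiply, Matrix.add_mul, huvu, hvuv, sub_eq_add_neg, add_comm]

/-- If `uvu = 0` and `vuv = 0`, then `⟦e₋(v), e₊(u)⟧` is the block diagonal matrix with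
blocks `1 + uv` and `1 - vu`. -/
theorem Matrix.fromBlocks_lower_upper_commutator {A : Type*} [Ring A] {I J : Type*}
    [Fintype I] [Fintype J] [DecidableEq I] [DecidableEq J]
    (u : Matrix I J A) (v : Matrix J I A)
    (huvu : u * v * u = 0) (hvuv : v * u * v = 0) :
    Matrix.fromBlocks 1 0 (-v) 1 * Matrix.fromBlocks 1 u 0 1 *
        Matrix.fromBlocks 1 0 v 1 * Matrix.fromBlocks 1 (-u) 0 1 =
      Matrix.fromBlocks (1 + u * v) 0 0 (1 - v * u) := by
  simp [Matrix.fromBlocks_multiply, Matrix.add_mul, huvu, hvuv, sub_eq_add_neg, add_comm]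

/-- If `uvu = 0`, `vuv = 0` and `uvzvu = 0`, then the double commutator
`⟦⟦e₊(u), e₋(v)⟧, e₊(z)⟧` equals `e₊(−{u,v,z})` where `{u,v,z} = uvz + zvu`. -/
theorem stmt_17 {A : Type*} [Ring A] {I J : Type*} [Fintype I] [Fintype J]
    [DecidableEq I] [DecidableEq J] [Nonempty I] [Nonempty J]
    (u z : Matrix I J A) (v : Matrix J I A)
    (huvu : u * v * u = 0) (hvuv : v * u * v = 0)
    (huvzvu : u * v * z * v * u = 0) :
    (Matrix.fromBlocks 1 u 0 1 * Matrix.fromBlocks 1 0 (-v) 1 *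
        Matrix.fromBlocks 1 (-u) 0 1 * Matrix.fromBlocks 1 0 v 1) *
      Matrix.fromBlocks 1 z 0 1 *
      (Matrix.fromBlocks 1 0 (-v) 1 * Matrix.fromBlocks 1 u 0 1 *
        Matrix.fromBlocks 1 0 v 1 * Matrix.fromBlocks 1 (-u) 0 1) *
      Matrix.fromBlocks 1 (-z) 0 1 =
      Matrix.fromBlocks 1 (-(u * v * z + z * v * u)) 0 1 := by
  have huv : (1 - u * v) * (1 + u * v) = 1 := by
    have h : u * v * (u * v) = 0 := by rw [← Matrix.mul_assoc, huvu, Matrix.zero_mul]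
    simp [Matrix.sub_mul, Matrix.mul_add, h]
  have hvu : (1 + v * u) * (1 - v * u) = 1 := by
    have h : v * u * (v * u) = 0 := by rw [← Matrix.mul_assoc, hvuv, Matrix.zero_mul]
    simp [Matrix.add_mul, Matrix.mul_sub, h]
  have hz : (1 - u * v) * z * (1 - v * u) - z = -(u * v * z + z * v * u) := by
    simp only [Matrix.sub_mul, Matrix.mul_sub, Matrix.one_mul, Matrix.mul_one,
      ← Matrix.mul_assoc, huvzvu]
    abel
  rw [Matrix.fromBlocks_upper_lower_commutator u v huvu hvuv,
    Matrix.fromBlocks_lower_upper_commutator u v huvu hvuv]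
  simp only [Matrix.fromBlocks_multiply, Matrix.mul_one, Matrix.mul_zero, Matrix.zero_mul,
    add_zero, zero_add, huv, hvu, Matrix.one_mul, ← hz]
  congr 1
  abel
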